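/- Let c be a two-dimensional uniformly recurrent configuration over a finite alphabet that has low complexity with respect to a rectangle D = {1,…,n} × {1,…,m}. If for some nonzero u ∈ ℤ² both u and −u are directions of non-determinism of the orbit closure of c, then c is periodic with a periodicity vector perpendicular to u, i.e., τ^p(c) = c for some nonzero p ∈ ℤ² with ⟨p, u⟩ = 0. -/

import Mathlib

/-- Translation of a configuration by `t`: `(Translate t c) n = c (n - t)`. -/
def Translate {A : Type*} (t : ℤ × ℤ) (c : ℤ × ℤ → A) : ℤ × ℤ → A :=
  fun n => c (n - t)

/-- The orbit of a configuration: the set of all its translates. -/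
def orbit {A : Type*} (c : ℤ × ℤ → A) : Set (ℤ × ℤ → A) :=
  { d | ∃ t : ℤ × ℤ, d = Translate t c }

/-- The orbit closure: the topological closure of the orbit (in the product
topology of the discrete topology on the alphabet). -/
def orbitClosure {A : Type*} [TopologicalSpace A] (c : ℤ × ℤ → A) : Set (ℤ × ℤ → A) :=
  closure (orbit c)

/-- The standard inner product on `ℤ²`. -/
def inner2 (x u : ℤ × ℤ) : ℤ := x.1 * u.1 + x.2 * u.2

/-- The discrete half plane in direction `u`. -/
def halfPlane (u : ℤ × ℤ) : Set (ℤ × ℤ) := { x | inner2 x u < 0 }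

/-- A set of configurations is deterministic in direction `u`: the contents of a
configuration on the half plane `H_u` determine the whole configuration. -/
def DeterministicIn {A : Type*} (X : Set (ℤ × ℤ → A)) (u : ℤ × ℤ) : Prop :=
  ∀ d ∈ X, ∀ e ∈ X, Set.EqOn d e (halfPlane u) → d = e

/-- The set of `D`-patterns appearing in `c` : restrictions of translates of `c` to `D`. -/
def patterns {A : Type*} (c : ℤ × ℤ → A) (D : Set (ℤ × ℤ)) : Set (D → A) :=
  { p | ∃ t : ℤ × ℤ, ∀ x : D, p x = Translate t c x }

/-- A configuration is periodic if it is fixed by some non-trivial translation. -/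
def Periodic {A : Type*} (c : ℤ × ℤ → A) : Prop :=
  ∃ t : ℤ × ℤ, t ≠ 0 ∧ Translate t c = c

/-- The discrete rectangle `{1,…,n} × {1,…,m}`. -/
def rect (n m : ℕ) : Set (ℤ × ℤ) :=
  { x | 1 ≤ x.1 ∧ x.1 ≤ (n : ℤ) ∧ 1 ≤ x.2 ∧ x.2 ≤ (m : ℤ) }

/-- Uniform recurrence: every element of the orbit closure generates the same
orbit closure. -/
def UniformlyRecurrent {A : Type*} [TopologicalSpace A] (c : ℤ × ℤ → A) : Prop :=
  ∀ c' ∈ orbitClosure c, orbitClosure c' = orbitClosure c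

/-- On a finite alphabet there is a common period for all bi-infinite sequences in which each
symbol determines its successor. -/
theorem exists_uniform_period (α : Type*) [Finite α] :
    ∃ M : ℕ, 0 < M ∧ ∀ f : ℤ → α, (∀ i j, f i = f j → f (i + 1) = f (j + 1)) →
      ∀ i, f (i + M) = f i := by
  refine ⟨(Nat.card α).factorial, Nat.factorial_pos _, fun f hf i => ?_⟩
  obtain ⟨s, t, hst, hlt⟩ : ∃ s t : Fin (Nat.card α + 1),
      f (i - Nat.card α + s) = f (i - Nat.card α + t) ∧ s < t := by
    have : Fintype α := Fintype.ofFinite α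
    obtain ⟨s, t, hne, heq⟩ := Fintype.exists_ne_map_eq_of_card_lt
      (fun s : Fin (Nat.card α + 1) => f (i - Nat.card α + s)) (by simp)
    rcases lt_or_gt_of_ne hne with h | h
    exacts [⟨s, t, heq, h⟩, ⟨t, s, heq.symm, h⟩]
  have hforward : ∀ k : ℕ, f (i - Nat.card α + s + k) = f (i - Nat.card α + t + k) := by
    intro k
    induction k with
    | zero => simpa using hst
    | succ k ih => simpa [add_assoc] using hf _ _ ih
  obtain ⟨p, hp⟩ : ∃ p : ℕ, (t : ℕ) = s + p := Nat.exists_eq_add_of_lt hlt |>.imp' (· + 1)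
    fun _ h => by omega
  have hs : (s : ℕ) < Nat.card α + 1 := s.2
  have ht : (t : ℕ) < Nat.card α + 1 := t.2
  have hlt' : (s : ℕ) < t := hlt
  have hstep : ∀ m : ℕ, f (i + (p * m : ℕ)) = f i := by
    intro m
    induction m with
    | zero => simp
    | succ m ih =>
      have h := hforward (Nat.card α - s + p * m)
      rw [← ih]
      convert h.symm using 2 <;> push_cast [Nat.cast_sub (Nat.lt_succ_iff.1 hs), hp] <;> ring
  obtain ⟨m, hm⟩ := Nat.dvd_factorial (by omega : 0 < p) (by omega : p ≤ Nat.card α)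
  rw [hm]
  exact hstep m

/-- **Morse–Hedlund**: a bi-infinite sequence with at most `k` factors of length `k` is periodic. -/
theorem exists_period_of_ncard_factors_le {β : Type*} (s : ℤ → β) (k : ℕ)
    (hfin : (Set.range fun (i : ℤ) (t : Fin k) => s (i + t)).Finite)
    (hcard : (Set.range fun (i : ℤ) (t : Fin k) => s (i + t)).ncard ≤ k) :
    ∃ q : ℕ, 0 < q ∧ ∀ i, s (i + q) = s i := by
  set W : (j : ℕ) → ℤ → Fin j → β := fun j i t => s (i + t) with hW
  have hres : ∀ j l, (h : j ≤ l) →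
      Set.range (W j) = (fun w => w ∘ Fin.castLE h) '' Set.range (W l) := by
    intro j l h
    rw [← Set.range_comp]
    rfl
  have hfin' : ∀ j ≤ k, (Set.range (W j)).Finite := fun j h => by
    rw [hres j k h]; exact hfin.image _
  by_cases hgrow : ∀ j < k, (Set.range (W j)).ncard < (Set.range (W (j + 1))).ncard
  · have hlow : ∀ j ≤ k, j + 1 ≤ (Set.range (W j)).ncard := by
      intro j
      induction j with
      | zero => exact fun h => (Set.ncard_pos (hfin' 0 h)).2 ⟨_, 0, rfl⟩
      | succ j ih => exact fun h => (Nat.succ_le_succ (ih (by omega))).trans (hgrow j h)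
    exact absurd (hlow k le_rfl) (Nat.not_le.2 (Nat.lt_succ_of_le hcard))
  push Not at hgrow
  obtain ⟨j, hj, hle⟩ := hgrow
  have hinj : Set.InjOn (fun w : Fin (j + 1) → β => w ∘ Fin.castLE j.le_succ)
      (Set.range (W (j + 1))) := by
    refine Set.injOn_of_ncard_image_eq (le_antisymm (Set.ncard_image_le (hfin' _ hj)) ?_)
      (hfin' _ hj)
    rw [← hres j (j + 1) j.le_succ]
    exact hle
  have := (hfin' (j + 1) hj).to_subtype
  obtain ⟨M, hM, hper⟩ := exists_uniform_period (Set.range (W (j + 1)))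
  refine ⟨M, hM, fun i => ?_⟩
  have h := hper (fun i => ⟨W (j + 1) i, Set.mem_range_self i⟩) (fun a b hab => by
    refine Subtype.ext (hinj (Set.mem_range_self _) (Set.mem_range_self _) (funext fun t => ?_))
    have := congrFun (congrArg Subtype.val hab) t.succ
    simpa [hW, add_assoc, add_comm (1 : ℤ)] using this) i
  simpa [hW] using congrFun (congrArg Subtype.val h) 0

/-- The patterns of shape `B` appearing at the origin in the members of `X`. -/
def language {ι A : Type*} (X : Set (ι → A)) (B : Finset ι) : Set (B → A) :=
  (fun x => B.restrict x) '' X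

/-- A pattern of shape `B'` with two different extensions to `B ⊇ B'` creates an additional
pattern of shape `B`. -/
theorem ncard_language_add_le {ι A : Type*} [Finite A] {X : Set (ι → A)} {B' B : Finset ι}
    (hB : B' ⊆ B) (Q : Set (B' → A))
    (hQ : ∀ q ∈ Q, ∃ x ∈ X, ∃ y ∈ X, B'.restrict x = q ∧ B'.restrict y = q ∧
      B.restrict x ≠ B.restrict y) :
    (language X B').ncard + Q.ncard ≤ (language X B).ncard := by
  classical
  have hlift : ∀ p : language X B', ∃ x ∈ X, B'.restrict x = p.1 := fun p => p.2
  choose lift hliftX hlift using hlift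
  set σ : language X B' → (B → A) := fun p => B.restrict (lift p) with hσ
  have hres : ∀ x y : ι → A, B.restrict x = B.restrict y → B'.restrict x = B'.restrict y :=
    fun _ _ h => congrArg (Finset.restrict₂ (π := fun _ => A) hB) h
  have hsecond : ∀ q : Q, ∃ y ∈ X, B'.restrict y = q.1 ∧ B.restrict y ∉ Set.range σ := by
    rintro ⟨q, hq⟩
    obtain ⟨x, hx, y, hy, hxq, hyq, hne⟩ := hQ q hq
    have hqX : q ∈ language X B' := ⟨x, hx, hxq⟩
    have hnot : ∀ z ∈ X, B'.restrict z = q → B.restrict z ∈ Set.range σ →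
        B.restrict z = σ ⟨q, hqX⟩ := by
      rintro z - hzq ⟨p, hp⟩
      have : p = ⟨q, hqX⟩ := Subtype.ext ((hlift p).symm.trans ((hres _ _ hp).trans hzq))
      rw [← hp, this]
    by_cases h : B.restrict x ∈ Set.range σ
    · exact ⟨y, hy, hyq, fun h' => hne ((hnot x hx hxq h).trans (hnot y hy hyq h').symm)⟩
    · exact ⟨x, hx, hxq, h⟩
  choose second hsecondX hsecond hnot using hsecond
  have hσinj : Function.Injective σ := fun p p' h => by
    exact Subtype.ext ((hlift p).symm.trans ((hres _ _ h).trans (hlift p')))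
  have hτinj : Function.Injective fun q => B.restrict (second q) := fun p p' h => by
    exact Subtype.ext ((hsecond p).symm.trans ((hres _ _ h).trans (hsecond p')))
  rw [← Nat.card_coe_set_eq, ← Nat.card_coe_set_eq Q,
    ← Set.ncard_range_of_injective hσinj, ← Set.ncard_range_of_injective hτinj,
    ← Set.ncard_union_eq]
  · refine Set.ncard_le_ncard ?_
    rintro _ (⟨p, rfl⟩ | ⟨q, rfl⟩)
    exacts [⟨_, hliftX p, rfl⟩, ⟨_, hsecondX q, rfl⟩]
  · rw [Set.disjoint_left]
    rintro _ hp ⟨q, rfl⟩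
    exact hnot q hp

/-- Reindexing along an equivalence does not change the number of patterns. -/
theorem ncard_language_comp {ι κ A : Type*} (X : Set (ι → A)) (σ : κ ≃ ι) (B : Finset κ) :
    (language ((fun x => x ∘ σ) '' X) B).ncard = (language X (B.map σ.toEmbedding)).ncard := by
  have hmem : ∀ b : B, σ b ∈ B.map σ.toEmbedding := fun b => Finset.mem_map_of_mem _ b.2
  have : language ((fun x => x ∘ σ) '' X) B =
      (fun (p : B.map σ.toEmbedding → A) (b : B) => p ⟨σ b, hmem b⟩) ''
        language X (B.map σ.toEmbedding) := by
    simp only [language, Set.image_image]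
    rfl
  rw [this, Set.ncard_image_of_injective]
  intro p p' h
  funext ⟨i, hi⟩
  obtain ⟨b, hb, rfl⟩ := Finset.mem_map.1 hi
  exact congrFun h ⟨b, hb⟩

/-- Low complexity yields a nontrivial affine relation between the symbols of a pattern. -/
theorem exists_affine_relation {ι A : Type*} [Finite A] (φ : A → ℚ) {X : Set (ι → A)}
    {B : Finset ι} (hX : X.Nonempty) (h : (language X B).ncard ≤ B.card) :
    ∃ f : ι → ℚ, (∀ b ∉ B, f b = 0) ∧ (∃ b ∈ B, f b ≠ 0) ∧
      ∃ f₀, ∀ x ∈ X, ∑ b ∈ B, f b * φ (x b) = f₀ := by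
  classical
  have := Fintype.ofFinite (language X B)
  let T : ((B → ℚ) × ℚ) →ₗ[ℚ] (language X B → ℚ) :=
    { toFun := fun f p => ∑ b, f.1 b * φ (p.1 b) + f.2
      map_add' := fun f g => by
        funext p
        simp only [Prod.fst_add, Prod.snd_add, Pi.add_apply, add_mul, Finset.sum_add_distrib]
        ring
      map_smul' := fun r f => by
        funext p
        simp only [Prod.smul_fst, Prod.smul_snd, Pi.smul_apply, smul_eq_mul, mul_assoc,
          RingHom.id_apply, mul_add, Finset.mul_sum] }
  have hker : LinearMap.ker T ≠ ⊥ := by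
    refine LinearMap.ker_ne_bot_of_finrank_lt ?_
    rw [Module.finrank_prod, Module.finrank_fintype_fun_eq_card, Module.finrank_fintype_fun_eq_card,
      Module.finrank_self, Fintype.card_coe, ← Nat.card_eq_fintype_card, Nat.card_coe_set_eq]
    omega
  obtain ⟨⟨g, g₀⟩, hg, hne⟩ := Submodule.exists_mem_ne_zero_of_ne_bot hker
  have hsum : ∀ x ∈ X, ∑ b : B, g b * φ (x b) + g₀ = 0 := fun x hx =>
    congrFun (LinearMap.mem_ker.1 hg) ⟨B.restrict x, x, hx, rfl⟩
  refine ⟨fun i => if hi : i ∈ B then g ⟨i, hi⟩ else 0, fun b hb => by simp [hb], ?_,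
    -g₀, fun x hx => ?_⟩
  · by_contra! hzero
    have hg0 : g = 0 := funext fun b => by simpa using hzero b b.2
    obtain ⟨x, hx⟩ := hX
    have := hsum x hx
    simp only [hg0, Pi.zero_apply, zero_mul, Finset.sum_const_zero, zero_add] at this
    exact hne (by rw [hg0, this]; rfl)
  · rw [← eq_neg_of_add_eq_zero_left (hsum x hx), ← Finset.sum_coe_sort B]
    exact Finset.sum_congr rfl fun b _ => by simp

/-- Finite-valued solutions of nontrivial linear recurrences of bounded order over `ℚ` have a
common period. -/
theorem exists_uniform_recurrence_period {V : Set ℚ} (hV : V.Finite) (lo hi : ℤ) :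
    ∃ M : ℕ, 0 < M ∧ ∀ h δ : ℤ → ℚ, (∃ t ∈ Finset.Icc lo hi, h t ≠ 0) → (∀ i, δ i ∈ V) →
      (∀ i, ∑ t ∈ Finset.Icc lo hi, h t * δ (i + t) = 0) → ∀ i, δ (i + M) = δ i := by
  have := hV.to_subtype
  obtain ⟨M, hM, hper⟩ := exists_uniform_period (Finset.Icc lo hi → V)
  refine ⟨M, hM, fun h δ ⟨t₀, ht₀, hne⟩ hδ hrec i => ?_⟩
  obtain ⟨T, hT, hmax⟩ := Finset.exists_max_image ((Finset.Icc lo hi).filter fun t => h t ≠ 0) id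
    ⟨t₀, by simp [hne, Finset.mem_Icc.1 ht₀]⟩
  simp only [Finset.mem_filter, Finset.mem_Icc, id] at hT hmax
  have key := hper (fun i t => ⟨δ (i + t), hδ _⟩) (fun i j hij => by
    have hij' : ∀ t, lo ≤ t → t ≤ hi → δ (i + t) = δ (j + t) := fun t h1 h2 =>
      congrArg Subtype.val (congrFun hij ⟨t, Finset.mem_Icc.2 ⟨h1, h2⟩⟩)
    have hlast : δ (i + 1 + hi) = δ (j + 1 + hi) := by
      have hsub : ∑ t ∈ Finset.Icc lo hi,
          h t * (δ (i + 1 + hi - T + t) - δ (j + 1 + hi - T + t)) = 0 := by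
        simp only [mul_sub, Finset.sum_sub_distrib, hrec, sub_zero]
      rw [Finset.sum_eq_single T] at hsub
      · have := (mul_eq_zero.1 hsub).resolve_left hT.2
        simp only [sub_add_cancel] at this
        exact sub_eq_zero.1 this
      · intro t ht htT
        rw [Finset.mem_Icc] at ht
        by_cases hz : h t = 0
        · rw [hz, zero_mul]
        have := hmax t ⟨ht, hz⟩
        have := hij' (1 + hi - T + t) (by omega) (by omega)
        rw [show i + 1 + hi - T + t = i + (1 + hi - T + t) by ring,
          show j + 1 + hi - T + t = j + (1 + hi - T + t) by ring, this, sub_self, mul_zero]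
      · intro hnot
        exact absurd (Finset.mem_Icc.2 hT.1) hnot
    funext ⟨t, ht⟩
    rw [Finset.mem_Icc] at ht
    refine Subtype.ext ?_
    rcases ht.2.eq_or_lt with rfl | hlt
    · exact hlast
    · have := hij' (1 + t) (by omega) (by omega)
      simpa only [add_assoc] using this) (i - t₀)
  have := congrArg Subtype.val (congrFun key ⟨t₀, ht₀⟩)
  simpa [sub_add_eq_add_sub] using this

/-- If the symbols of `d` satisfy a fixed nontrivial affine relation supported on `b - a + 1`
consecutive rows, then horizontal periodicity of `b - a` consecutive rows of `d` spreads to all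
rows, for every period divisible by some constant depending only on the relation. -/
theorem exists_forall_row_periodic {A : Type*} [Finite A] {φ : A → ℚ} (hφ : φ.Injective)
    (f : ℤ × ℤ → ℚ) (f₀ : ℚ) (a b lo hi : ℤ)
    (hf : ∃ r ∈ Finset.Icc a b, ∃ t ∈ Finset.Icc lo hi, f (r, t) ≠ 0) :
    ∃ M : ℕ, 0 < M ∧ ∀ q : ℕ, 0 < q → M ∣ q → ∀ d : ℤ × ℤ → A,
      (∀ i j, ∑ r ∈ Finset.Icc a b, ∑ t ∈ Finset.Icc lo hi, f (r, t) * φ (d (i + r, j + t)) = f₀) →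
      (∀ r, a ≤ r → r < b → ∀ j, d (r, j + q) = d (r, j)) → ∀ r j, d (r, j + q) = d (r, j) := by
  obtain ⟨M, hM, hper⟩ := exists_uniform_recurrence_period
    (Set.finite_range fun p : A × A => φ p.1 - φ p.2) lo hi
  refine ⟨M, hM, fun q hq hMq d hrel hstrip => ?_⟩
  set δ : ℤ → ℤ → ℚ := fun r j => φ (d (r, j + q)) - φ (d (r, j)) with hδ
  have hδ0 : ∀ r j, δ r j = 0 ↔ d (r, j + q) = d (r, j) := fun r j =>
    sub_eq_zero.trans hφ.eq_iff
  have hδrel : ∀ i j, ∑ r ∈ Finset.Icc a b, ∑ t ∈ Finset.Icc lo hi,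
      f (r, t) * δ (i + r) (j + t) = 0 := by
    intro i j
    have h1 := hrel i (j + q)
    have h2 := hrel i j
    simp only [hδ, mul_sub, Finset.sum_sub_distrib]
    rw [h2, sub_eq_zero, ← h1]
    simp only [add_right_comm]
  have hrow : ∀ R r₀, r₀ ∈ Finset.Icc a b → (∃ t ∈ Finset.Icc lo hi, f (r₀, t) ≠ 0) →
      (∀ r ∈ Finset.Icc a b, (∃ t ∈ Finset.Icc lo hi, f (r, t) ≠ 0) → r ≠ r₀ →
        ∀ j, δ (R + r - r₀) j = 0) → ∀ j, δ R j = 0 := by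
    intro R r₀ hr₀ hne hzero j
    have hMper := hper (fun t => f (r₀, t)) (δ R) hne (fun i => ⟨(_, _), rfl⟩) (fun i => by
      have h := hδrel (R - r₀) i
      rw [Finset.sum_eq_single r₀] at h
      · simpa using h
      · intro r hr hrr
        refine Finset.sum_eq_zero fun t ht => ?_
        by_cases hz : f (r, t) = 0
        · rw [hz, zero_mul]
        · rw [sub_add_eq_add_sub, hzero r hr ⟨t, ht, hz⟩ hrr, mul_zero]
      · exact fun h => absurd hr₀ h)
    obtain ⟨k, rfl⟩ := hMq
    have hmulper : ∀ l : ℕ, δ R (j + (M * l : ℕ)) = δ R j := by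
      intro l
      induction l with
      | zero => simp
      | succ l ih => rw [← ih, ← hMper (j + (M * l : ℕ))]; congr 1; push_cast; ring
    have hlin : ∀ l : ℕ, φ (d (R, j + (M * k * l : ℕ))) = φ (d (R, j)) + l * δ R j := by
      intro l
      induction l with
      | zero => simp
      | succ l ih =>
        have h1 := hmulper (k * l)
        rw [← mul_assoc] at h1
        have h2 : δ R (j + (M * k * l : ℕ)) = φ (d (R, j + (M * k * (l + 1) : ℕ))) -
            φ (d (R, j + (M * k * l : ℕ))) := by
          simp only [hδ]; congr 4; push_cast; ring
        push_cast at *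
        linarith
    obtain ⟨l, l', hll, heq⟩ :=
      Finite.exists_ne_map_eq_of_infinite fun l : ℕ => d (R, j + (M * k * l : ℕ))
    have h1 := hlin l
    rw [show d (R, j + (M * k * l : ℕ)) = _ from heq, hlin l'] at h1
    have h2 : ((l' : ℚ) - l) * δ R j = 0 := by linarith
    exact (mul_eq_zero.1 h2).resolve_left (sub_ne_zero.2 (by exact_mod_cast hll.symm))
  obtain ⟨r, hr, hrne⟩ := hf
  have hS : ((Finset.Icc a b).filter fun r => ∃ t ∈ Finset.Icc lo hi, f (r, t) ≠ 0).Nonempty :=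
    ⟨r, Finset.mem_filter.2 ⟨hr, hrne⟩⟩
  obtain ⟨rmax, hrmax, hmax⟩ := Finset.exists_max_image _ id hS
  obtain ⟨rmin, hrmin, hmin⟩ := Finset.exists_min_image _ id hS
  simp only [Finset.mem_filter, id, and_imp] at hrmax hrmin hmax hmin
  have hall : ∀ k : ℕ, ∀ r, a - k ≤ r → r < b + k → ∀ j, δ r j = 0 := by
    intro k
    induction k with
    | zero =>
      intro r h1 h2 j
      exact (hδ0 r j).2 (hstrip r (by simpa using h1) (by simpa using h2) j)
    | succ k ih =>
      intro r h1 h2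
      push_cast at h1 h2
      by_cases hlow : r < a - k
      · refine hrow r rmin hrmin.1 hrmin.2 fun s hs hsne hne => ih _ ?_ ?_
        all_goals
          have := hmin s hs hsne
          have := Finset.mem_Icc.1 hrmin.1
          rw [Finset.mem_Icc] at hs
          omega
      by_cases hhigh : b + k ≤ r
      · refine hrow r rmax hrmax.1 hrmax.2 fun s hs hsne hne => ih _ ?_ ?_
        all_goals
          have := hmax s hs hsne
          have := Finset.mem_Icc.1 hrmax.1
          rw [Finset.mem_Icc] at hs
          omega
      exact ih r (by omega) (by omega)
  intro r j
  exact (hδ0 r j).1 (hall (r.natAbs + a.natAbs + b.natAbs + 1) r (by omega) (by omega) j)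

/-- The finite region with rows `a, …, b` whose row `r` is the interval of length `len r`
starting at `lo r`. -/
noncomputable def strip (lo : ℤ → ℤ) (len : ℤ → ℕ) (a b : ℤ) : Finset (ℤ × ℤ) :=
  ((Finset.Icc a b).sigma fun r => Finset.Ico (lo r) (lo r + len r)).map
    (Equiv.sigmaEquivProd ℤ ℤ).toEmbedding

theorem mem_strip {lo : ℤ → ℤ} {len : ℤ → ℕ} {a b : ℤ} {p : ℤ × ℤ} :
    p ∈ strip lo len a b ↔ (a ≤ p.1 ∧ p.1 ≤ b) ∧ lo p.1 ≤ p.2 ∧ p.2 < lo p.1 + len p.1 := by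
  simp [strip]

theorem card_strip (lo : ℤ → ℤ) (len : ℤ → ℕ) (a b : ℤ) :
    (strip lo len a b).card = ∑ r ∈ Finset.Icc a b, len r := by
  simp [strip]

theorem card_strip_top (lo : ℤ → ℤ) (len : ℤ → ℕ) {a b : ℤ} (hab : a ≤ b) :
    (strip lo len a b).card = (strip lo len a (b - 1)).card + len b := by
  have : Finset.Icc a b = insert b (Finset.Icc a (b - 1)) := by
    ext r; simp only [Finset.mem_Icc, Finset.mem_insert]; omega
  rw [card_strip, card_strip, this, Finset.sum_insert (by simp), add_comm]

theorem card_strip_bottom (lo : ℤ → ℤ) (len : ℤ → ℕ) {a b : ℤ} (hab : a ≤ b) :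
    (strip lo len a b).card = (strip lo len (a + 1) b).card + len a := by
  have : Finset.Icc a b = insert a (Finset.Icc (a + 1) b) := by
    ext r; simp only [Finset.mem_Icc, Finset.mem_insert]; omega
  rw [card_strip, card_strip, this, Finset.sum_insert (by simp), add_comm]

/-- A set of configurations that is invariant under translations. -/
def ShiftInvariant {A : Type*} (X : Set (ℤ × ℤ → A)) : Prop :=
  ∀ x ∈ X, ∀ t : ℤ × ℤ, (fun p => x (t + p)) ∈ X

/-- If every step of a chain of `n` extensions of shapes is ambiguous for `X`, then at least `n`
patterns are gained along the chain. -/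
theorem ncard_language_chain_le {ι A : Type*} [Finite A] {X : Set (ι → A)} (C : ℕ → Finset ι)
    (n : ℕ) (hmono : ∀ t < n, C t ⊆ C (t + 1))
    (hamb : ∀ t < n, ∃ x ∈ X, ∃ y ∈ X, (∀ p ∈ C t, x p = y p) ∧ ∃ p ∈ C (t + 1), x p ≠ y p) :
    (language X (C 0)).ncard + n ≤ (language X (C n)).ncard := by
  induction n with
  | zero => simp
  | succ n ih =>
    obtain ⟨x, hx, y, hy, hagree, p, hp, hne⟩ := hamb n n.lt_succ_self
    have h := ncard_language_add_le (X := X) (hmono n n.lt_succ_self) {(C n).restrict x} (by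
      rintro q rfl
      exact ⟨x, hx, y, hy, rfl, funext fun p => (hagree p p.2).symm,
        fun h => hne (congrFun h ⟨p, hp⟩)⟩)
    rw [Set.ncard_singleton] at h
    have := ih (fun t ht => hmono t (ht.trans n.lt_succ_self))
      fun t ht => hamb t (ht.trans n.lt_succ_self)
    omega

/-- Let two members of `X` agree below row `b` and disagree on row `b`. If the top row of a strip
has few ambiguous extensions, then the disagreements are relatively dense on row `b`. -/
theorem exists_ne_of_window {A : Type*} [Finite A] {X : Set (ℤ × ℤ → A)} (hX : ShiftInvariant X)
    {lo : ℤ → ℤ} {len : ℤ → ℕ} {a b : ℤ} (hab : a ≤ b)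
    (hgrow : (language X (strip lo len a b)).ncard <
      (language X (strip lo len a (b - 1))).ncard + len b)
    {d e : ℤ × ℤ → A} (hd : d ∈ X) (he : e ∈ X) (hde : ∀ p : ℤ × ℤ, p.1 < b → d p = e p)
    (hne : ∃ j, d (b, j) ≠ e (b, j)) (i : ℤ) :
    ∃ j, i ≤ j ∧ j < i + len b ∧ d (b, j) ≠ e (b, j) := by
  by_contra! hwin
  obtain ⟨j₀, hj₀⟩ := hne
  rcases le_or_gt (i + len b) j₀ with hj | hj
  · obtain ⟨x, ⟨hx, hxne⟩, hmin⟩ := Int.exists_least_of_bdd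
      (P := fun x => i + len b ≤ x ∧ d (b, x) ≠ e (b, x)) ⟨i + len b, fun z hz => hz.1⟩
      ⟨j₀, hj, hj₀⟩
    have h := ncard_language_chain_le (X := X)
      (fun t => strip lo (Function.update len b t) a b) (len b) ?_ ?_
    · rw [Function.update_eq_self] at h
      have h0 : strip lo (Function.update len b 0) a b = strip lo len a (b - 1) := by
        ext ⟨r, j⟩
        simp only [mem_strip, Function.update_apply]
        split_ifs <;> simp <;> omega
      rw [h0] at h
      omega
    · rintro t - ⟨r, j⟩
      simp only [mem_strip, Function.update_apply]
      split_ifs <;> push_cast <;> omega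
    · intro t ht
      refine ⟨_, hX d hd (0, x - lo b - t), _, hX e he (0, x - lo b - t), ?_,
        (b, lo b + t), ?_, ?_⟩
      · rintro ⟨r, j⟩ hp
        simp only [mem_strip, Function.update_apply] at hp
        rcases hp.1.2.lt_or_eq with hr | rfl
        · exact hde _ (by simpa using hr)
        · rw [if_pos rfl] at hp
          simp only [Prod.mk_add_mk, zero_add]
          by_contra hcon
          rcases lt_or_ge (x - lo r - t + j) (i + len r) with hlt | hge
          · exact hcon (hwin _ (by omega) hlt)
          · have := hmin _ ⟨hge, hcon⟩
            omega
      · simp [mem_strip, hab]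
      · simpa using hxne
  · have hji : j₀ < i := by
      by_contra! h
      exact hj₀ (hwin j₀ h hj)
    obtain ⟨x, ⟨hx, hxne⟩, hmax⟩ := Int.exists_greatest_of_bdd
      (P := fun x => x < i ∧ d (b, x) ≠ e (b, x)) ⟨i, fun z hz => hz.1.le⟩ ⟨j₀, hji, hj₀⟩
    have h := ncard_language_chain_le (X := X)
      (fun t => strip (Function.update lo b (lo b + len b - t)) (Function.update len b t) a b)
      (len b) ?_ ?_
    · rw [Function.update_eq_self, add_sub_cancel_right, Function.update_eq_self] at h
      have h0 : strip (Function.update lo b (lo b + len b - (0 : ℕ))) (Function.update len b 0) a b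
          = strip lo len a (b - 1) := by
        ext ⟨r, j⟩
        simp only [mem_strip, Function.update_apply]
        split_ifs <;> simp <;> omega
      rw [h0] at h
      omega
    · rintro t - ⟨r, j⟩
      simp only [mem_strip, Function.update_apply]
      split_ifs <;> push_cast <;> omega
    · intro t ht
      refine ⟨_, hX d hd (0, x - (lo b + len b - t - 1)), _,
        hX e he (0, x - (lo b + len b - t - 1)), ?_, (b, lo b + len b - t - 1), ?_, ?_⟩
      · rintro ⟨r, j⟩ hp
        simp only [mem_strip, Function.update_apply] at hp
        rcases hp.1.2.lt_or_eq with hr | rfl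
        · exact hde _ (by simpa using hr)
        · simp only [if_true] at hp
          simp only [Prod.mk_add_mk, zero_add]
          by_contra hcon
          rcases lt_or_ge (x - (lo r + len r - t - 1) + j) i with hlt | hge
          · have := hmax _ ⟨hlt, hcon⟩
            omega
          · exact hcon (hwin _ hge (by omega))
      · simp only [mem_strip, Function.update_apply, if_true]
        push_cast
        omega
      · simpa using hxne

/-- Ambiguity above a balanced strip forces horizontal periodicity. -/
theorem exists_row_period_of_balanced {A : Type*} [Finite A] {X : Set (ℤ × ℤ → A)}
    (hX : ShiftInvariant X) {lo : ℤ → ℤ} {len : ℤ → ℕ} {a b : ℤ} (hab : a ≤ b)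
    (hlow : (language X (strip lo len a b)).ncard ≤ (strip lo len a b).card)
    (hgrow : (language X (strip lo len a b)).ncard <
      (language X (strip lo len a (b - 1))).ncard + len b)
    (hlen : ∀ r, a ≤ r → r ≤ b → len b ≤ len r + 1)
    {d e : ℤ × ℤ → A} (hd : d ∈ X) (he : e ∈ X) (hde : ∀ p : ℤ × ℤ, p.1 < b → d p = e p)
    (hne : ∃ j, d (b, j) ≠ e (b, j)) :
    ∃ q : ℕ, 0 < q ∧ ∀ p : ℤ × ℤ, d (p + (0, (q : ℤ))) = d p := by
  have hsub : strip lo len a (b - 1) ⊆ strip lo len a b := fun p hp => by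
    rw [mem_strip] at *; omega
  set Q : Set (strip lo len a (b - 1) → A) := {q | ∃ x ∈ X, ∃ y ∈ X,
    (strip lo len a (b - 1)).restrict x = q ∧ (strip lo len a (b - 1)).restrict y = q ∧
      (strip lo len a b).restrict x ≠ (strip lo len a b).restrict y} with hQ
  have hQcard : Q.ncard ≤ len b - 1 := by
    have := ncard_language_add_le (X := X) hsub Q fun q hq => hq
    omega
  have hmemQ : ∀ i : ℤ, (strip lo len a (b - 1)).restrict (fun p => d ((0, i) + p)) ∈ Q := by
    intro i
    obtain ⟨j, hj₁, hj₂, hj⟩ := exists_ne_of_window hX hab hgrow hd he hde hne (lo b + i)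
    refine ⟨_, hX d hd (0, i), _, hX e he (0, i), rfl, funext fun p => ?_, fun h => hj ?_⟩
    · have := (mem_strip.1 p.2).1.2
      exact (hde _ (by simp; omega)).symm
    · have := congrFun h ⟨(b, j - i), mem_strip.2 (by simp; omega)⟩
      simpa using this
  set s : ℤ → Finset.Icc a (b - 1) → A := fun i r => d (r, lo r + i) with hs
  have hrange : (Set.range fun (i : ℤ) (t : Fin (len b - 1)) => s (i + t)) ⊆
      (fun (p : strip lo len a (b - 1) → A) (t : Fin (len b - 1)) (r : Finset.Icc a (b - 1)) =>
        p ⟨(r, lo r + t), by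
          have hr := Finset.mem_Icc.1 r.2
          have := hlen r hr.1 (by omega)
          have := t.2
          rw [mem_strip]
          simp only [Finset.mem_Icc.1 r.2, true_and]
          omega⟩) '' Q := by
    rintro _ ⟨i, rfl⟩
    refine ⟨_, hmemQ i, ?_⟩
    funext t r
    simp only [hs, Finset.restrict, Prod.mk_add_mk, zero_add]
    congr 2
    ring
  obtain ⟨q₀, hq₀, hper⟩ := exists_period_of_ncard_factors_le s (len b - 1)
    ((Q.toFinite.image _).subset hrange)
    ((Set.ncard_le_ncard hrange (Q.toFinite.image _)).trans
      ((Set.ncard_image_le Q.toFinite).trans hQcard))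
  obtain ⟨φ, hφ⟩ : ∃ φ : A → ℚ, φ.Injective := by
    obtain ⟨k, ⟨g⟩⟩ := Finite.exists_equiv_fin A
    exact ⟨fun x => ((g x : ℕ) : ℚ), fun x y h => g.injective (Fin.ext (Nat.cast_injective (R := ℚ) h))⟩
  obtain ⟨f, hf0, ⟨⟨r, t⟩, hrt, hfne⟩, f₀, hf⟩ := exists_affine_relation φ ⟨d, hd⟩ hlow
  obtain ⟨lo', hlo'⟩ := ((strip lo len a b).image Prod.snd).bddBelow
  obtain ⟨hi', hhi'⟩ := ((strip lo len a b).image Prod.snd).bddAbove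
  have hbox : strip lo len a b ⊆ Finset.Icc a b ×ˢ Finset.Icc lo' hi' := fun p hp =>
    Finset.mem_product.2 ⟨Finset.mem_Icc.2 (mem_strip.1 hp).1,
      Finset.mem_Icc.2 ⟨hlo' (Finset.mem_image_of_mem _ hp), hhi' (Finset.mem_image_of_mem _ hp)⟩⟩
  have hrt' := Finset.mem_product.1 (hbox hrt)
  obtain ⟨M, hM, hspread⟩ :=
    exists_forall_row_periodic hφ f f₀ a b lo' hi' ⟨r, hrt'.1, t, hrt'.2, hfne⟩
  refine ⟨M * q₀, by positivity, fun p => ?_⟩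
  rw [show p + (0, ((M * q₀ : ℕ) : ℤ)) = (p.1, p.2 + (M * q₀ : ℕ)) by ext <;> simp]
  refine hspread (M * q₀) (by positivity) (dvd_mul_right _ _) d (fun i j => ?_)
    (fun r hra hrb j => ?_) p.1 p.2
  · rw [← hf _ (hX d hd (i, j)), Finset.sum_subset hbox fun p _ hp => by rw [hf0 p hp, zero_mul],
      Finset.sum_product]
    rfl
  · have hrow : Function.Periodic (fun j => d (r, j)) (q₀ : ℤ) := fun j => by
      have := congrFun (hper (j - lo r)) ⟨r, Finset.mem_Icc.2 ⟨hra, by omega⟩⟩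
      simpa [hs, ← add_assoc] using this
    simpa using hrow.nat_mul M j

/-- If `X` has a balanced strip and two distinct members that agree on the lower half plane, then
some member of `X` is horizontally periodic. -/
theorem exists_row_periodic_mem_of_balanced {A : Type*} [Finite A] {X : Set (ℤ × ℤ → A)}
    (hX : ShiftInvariant X) {lo : ℤ → ℤ} {len : ℤ → ℕ} {a b : ℤ} (hab : a ≤ b)
    (hlow : (language X (strip lo len a b)).ncard ≤ (strip lo len a b).card)
    (hgrow : (language X (strip lo len a b)).ncard <
      (language X (strip lo len a (b - 1))).ncard + len b)
    (hlen : ∀ r, a ≤ r → r ≤ b → len b ≤ len r + 1)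
    (hnd : ∃ d ∈ X, ∃ e ∈ X, (∀ p : ℤ × ℤ, p.1 < 0 → d p = e p) ∧ d ≠ e) :
    ∃ d ∈ X, ∃ q : ℕ, 0 < q ∧ ∀ p : ℤ × ℤ, d (p + (0, (q : ℤ))) = d p := by
  obtain ⟨d, hd, e, he, hde, hne⟩ := hnd
  obtain ⟨⟨r₀, j₀⟩, hr₀⟩ := Function.ne_iff.1 hne
  obtain ⟨R, ⟨j, hR⟩, hmin⟩ := Int.exists_least_of_bdd (P := fun r => ∃ j, d (r, j) ≠ e (r, j))
    ⟨0, fun r ⟨j, hj⟩ => not_lt.1 fun h => hj (hde _ h)⟩ ⟨r₀, j₀, hr₀⟩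
  refine ⟨_, hX d hd (R - b, 0), exists_row_period_of_balanced hX hab hlow hgrow hlen
    (hX d hd (R - b, 0)) (hX e he (R - b, 0)) (fun p hp => ?_) ⟨j, by simpa using hR⟩⟩
  by_contra hcon
  have := hmin (R - b + p.1) ⟨0 + p.2, hcon⟩
  omega

theorem strip_map_neg (lo : ℤ → ℤ) (len : ℤ → ℕ) (a b : ℤ) :
    (strip (fun r => lo (-r)) (fun r => len (-r)) a b).map
      ((Equiv.neg ℤ).prodCongr (Equiv.refl ℤ)).toEmbedding = strip lo len (-b) (-a) := by
  ext ⟨r, j⟩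
  rw [Finset.mem_map_equiv, mem_strip, mem_strip]
  simp
  omega

/-- Low complexity on a convex strip together with two-sided non-determinism yields a
horizontally periodic configuration. -/
theorem exists_row_periodic_mem {A : Type*} [Finite A] {X : Set (ℤ × ℤ → A)}
    (hX : ShiftInvariant X) {lo : ℤ → ℤ} {len : ℤ → ℕ}
    (hlen : ∀ r₁ r r₂, r₁ ≤ r → r ≤ r₂ → min (len r₁) (len r₂) ≤ len r + 1)
    (hup : ∃ d ∈ X, ∃ e ∈ X, (∀ p : ℤ × ℤ, p.1 < 0 → d p = e p) ∧ d ≠ e)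
    (hdown : ∃ d ∈ X, ∃ e ∈ X, (∀ p : ℤ × ℤ, 0 < p.1 → d p = e p) ∧ d ≠ e) (k : ℕ) :
    ∀ a b : ℤ, b + 1 - a ≤ k →
      (language X (strip lo len a b)).ncard ≤ (strip lo len a b).card →
      ∃ d ∈ X, ∃ q : ℕ, 0 < q ∧ ∀ p : ℤ × ℤ, d (p + (0, (q : ℤ))) = d p := by
  induction k with
  | zero =>
    intro a b hab hlow
    rw [card_strip, Finset.Icc_eq_empty (by push_cast at hab; omega), Finset.sum_empty,
      Nat.le_zero, Set.ncard_eq_zero] at hlow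
    obtain ⟨d, hd, -⟩ := hup
    exact absurd ⟨d, hd, rfl⟩ (Set.eq_empty_iff_forall_notMem.1 hlow (Finset.restrict _ d))
  | succ k ih =>
    intro a b hk hlow
    push_cast at hk
    rcases lt_or_ge b a with hab | hab
    · exact ih a b (by omega) hlow
    rcases le_total (len b) (len a) with hba | hba
    · by_cases hrec : (language X (strip lo len a (b - 1))).ncard ≤ (strip lo len a (b - 1)).card
      · exact ih a (b - 1) (by omega) hrec
      · have := card_strip_top lo len hab
        exact exists_row_periodic_mem_of_balanced hX hab hlow (by omega)
          (fun r h₁ h₂ => by simpa [hba] using hlen a r b h₁ h₂) hup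
    · by_cases hrec : (language X (strip lo len (a + 1) b)).ncard ≤ (strip lo len (a + 1) b).card
      · exact ih (a + 1) b (by omega) hrec
      · have hcard := card_strip_bottom lo len hab
        set σ : ℤ × ℤ ≃ ℤ × ℤ := (Equiv.neg ℤ).prodCongr (Equiv.refl ℤ) with hσ
        have hσadd : ∀ s t : ℤ × ℤ, σ (s + t) = σ s + σ t := fun s t => by
          ext <;> simp [hσ, add_comm]
        have hσσ : ∀ p, σ (σ p) = p := fun p => by ext <;> simp [hσ]
        have hmap := strip_map_neg lo len
        rw [← hσ] at hmap
        have h1 : (strip lo len a b).card =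
            (strip (fun r => lo (-r)) (fun r => len (-r)) (-b) (-a)).card := by
          have := congrArg Finset.card (hmap (-b) (-a))
          rw [Finset.card_map, neg_neg, neg_neg] at this
          exact this.symm
        obtain ⟨_, ⟨d, hd, rfl⟩, q, hq, hper⟩ := exists_row_periodic_mem_of_balanced
          (X := (fun x => x ∘ σ) '' X) (lo := fun r => lo (-r)) (len := fun r => len (-r))
          (a := -b) (b := -a) (by
            rintro _ ⟨x, hx, rfl⟩ t
            exact ⟨_, hX x hx (σ t), funext fun p => by simp [hσadd]⟩)
          (by omega)
          (by rwa [ncard_language_comp, hmap, ← h1, neg_neg, neg_neg])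
          (by
            rw [ncard_language_comp, ncard_language_comp, hmap, hmap, neg_neg, neg_neg, neg_sub,
              sub_neg_eq_add, add_comm 1 a]
            omega)
          (fun r h₁ h₂ => by
            have := hlen a (-r) b (by omega) (by omega)
            simpa [hba] using this)
          (by
            obtain ⟨d, hd, e, he, hde, hne⟩ := hdown
            refine ⟨_, ⟨d, hd, rfl⟩, _, ⟨e, he, rfl⟩, fun p hp => hde _ ?_, fun h => hne ?_⟩
            · simpa [hσ] using hp
            · exact σ.surjective.injective_comp_right h)
        refine ⟨d, hd, q, hq, fun p => ?_⟩
        have h := hper (σ p)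
        simp only [Function.comp_apply, hσadd, hσσ] at h
        simpa [hσ] using h

/-- The unimodular change of coordinates sending `(r, j)` to `r • w + j • v`, where
`v = (-u.2, u.1)` is perpendicular to `u` and `⟨w, u⟩ = 1`. -/
def rowEquiv (u w : ℤ × ℤ) (h : inner2 w u = 1) : ℤ × ℤ ≃ ℤ × ℤ where
  toFun p := (p.1 * w.1 - p.2 * u.2, p.1 * w.2 + p.2 * u.1)
  invFun x := (inner2 x u, w.1 * x.2 - w.2 * x.1)
  left_inv p := by
    unfold inner2 at *
    ext
    · linear_combination p.1 * h
    · linear_combination p.2 * h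
  right_inv x := by
    unfold inner2 at *
    ext
    · linear_combination x.1 * h
    · linear_combination x.2 * h

theorem rowEquiv_add (u w : ℤ × ℤ) (h : inner2 w u = 1) (p q : ℤ × ℤ) :
    rowEquiv u w h (p + q) = rowEquiv u w h p + rowEquiv u w h q := by
  ext <;> simp [rowEquiv] <;> ring

theorem inner2_rowEquiv (u w : ℤ × ℤ) (h : inner2 w u = 1) (p : ℤ × ℤ) :
    inner2 (rowEquiv u w h p) u = p.1 :=
  congrArg Prod.fst ((rowEquiv u w h).left_inv p)

/-- A lower bound for an affine function at the corners of a parallel trapezoid holds throughout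
the trapezoid. -/
theorem le_of_mem_trapezoid {A α β r₁ r r₂ x y j l : ℤ} (h₁ : r₁ ≤ r) (h₂ : r ≤ r₂)
    (h : r₁ < r₂)
    (hx : A ≤ r₁ * α + x * β) (hx' : A ≤ r₁ * α + (x + l) * β)
    (hy : A ≤ r₂ * α + y * β) (hy' : A ≤ r₂ * α + (y + l) * β)
    (hj : (r₂ - r) * x + (r - r₁) * y ≤ (r₂ - r₁) * j)
    (hj' : (r₂ - r₁) * j ≤ (r₂ - r) * (x + l) + (r - r₁) * (y + l)) :
    A ≤ r * α + j * β := by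
  have hs : 0 ≤ r₂ - r := by omega
  have hs' : 0 ≤ r - r₁ := by omega
  have hL : 0 < r₂ - r₁ := by omega
  refine le_of_mul_le_mul_left ?_ hL
  rcases le_total 0 β with hβ | hβ
  · linarith [mul_le_mul_of_nonneg_left hx hs, mul_le_mul_of_nonneg_left hy hs',
      mul_le_mul_of_nonneg_right hj hβ]
  · linarith [mul_le_mul_of_nonneg_left hx' hs, mul_le_mul_of_nonneg_left hy' hs',
      mul_le_mul_of_nonpos_right hj' hβ]

/-- A finite order-connected set of integers is a half-open interval. -/
theorem exists_eq_Ico_of_ordConnected {S : Set ℤ} (hS : S.Finite) (hc : S.OrdConnected) :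
    ∃ (lo : ℤ) (len : ℕ), ∀ j, j ∈ S ↔ lo ≤ j ∧ j < lo + len := by
  rcases S.eq_empty_or_nonempty with rfl | hne
  · exact ⟨0, 0, fun j => by simp⟩
  obtain ⟨x, hx, hmin⟩ := S.exists_min_image id hS hne
  obtain ⟨y, hy, hmax⟩ := S.exists_max_image id hS hne
  have hxy : x ≤ y := hmin y hy
  refine ⟨x, (y - x + 1).toNat, fun j => ⟨fun hj => ?_, fun hj => hc.out hx hy ⟨hj.1, by omega⟩⟩⟩
  have h1 : x ≤ j := hmin j hj
  have h2 : j ≤ y := hmax j hj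
  omega

theorem rect_eq_coe (n m : ℕ) :
    rect n m = ↑(Finset.Icc (1 : ℤ) n ×ˢ Finset.Icc (1 : ℤ) m) := by
  ext x
  simp only [rect, Set.mem_ofPred_eq, Finset.mem_coe, Finset.mem_product, Finset.mem_Icc, and_assoc]

/-- The rows of a rectangle, taken perpendicular to `u`, are intervals whose lengths are almost
quasi-concave. -/
theorem exists_rect_rows (n m : ℕ) (u w : ℤ × ℤ) (h : inner2 w u = 1) :
    ∃ (lo : ℤ → ℤ) (len : ℤ → ℕ),
      (∀ r j, rowEquiv u w h (r, j) ∈ rect n m ↔ lo r ≤ j ∧ j < lo r + len r) ∧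
      ∀ r₁ r r₂, r₁ ≤ r → r ≤ r₂ → min (len r₁) (len r₂) ≤ len r + 1 := by
  have hrow : ∀ r, ∃ (lo : ℤ) (len : ℕ), ∀ j,
      j ∈ {j | rowEquiv u w h (r, j) ∈ rect n m} ↔ lo ≤ j ∧ j < lo + len := by
    intro r
    refine exists_eq_Ico_of_ordConnected ?_ ⟨fun j₁ hj₁ j₂ hj₂ j hj => ?_⟩
    · have hfin : (rect n m).Finite := by rw [rect_eq_coe]; exact Finset.finite_toSet _
      refine Set.Finite.preimage (fun a _ b _ hab => ?_) hfin
      exact congrArg Prod.snd ((rowEquiv u w h).injective hab)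
    · simp only [rect, rowEquiv, Equiv.coe_fn_mk, Set.mem_ofPred_eq] at hj₁ hj₂ ⊢
      obtain ⟨hj, hj'⟩ := hj
      refine ⟨?_, ?_, ?_, ?_⟩
      · rcases le_total 0 u.2 with h0 | h0 <;> nlinarith
      · rcases le_total 0 u.2 with h0 | h0 <;> nlinarith
      · rcases le_total 0 u.1 with h0 | h0 <;> nlinarith
      · rcases le_total 0 u.1 with h0 | h0 <;> nlinarith
  choose lo len hmem using hrow
  refine ⟨lo, len, hmem, fun r₁ r r₂ h₁ h₂ => ?_⟩
  rcases h₁.eq_or_lt with rfl | h₁'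
  · omega
  by_contra! hlt
  obtain ⟨l, hl⟩ : ∃ l : ℕ, min (len r₁) (len r₂) = l + 2 := ⟨min (len r₁) (len r₂) - 2, by omega⟩
  have hL : 0 < r₂ - r₁ := by omega
  set θ := (r₂ - r) * lo r₁ + (r - r₁) * lo r₂ with hθ
  obtain ⟨j, hj, hj'⟩ : ∃ j, θ ≤ (r₂ - r₁) * j ∧ (r₂ - r₁) * j < θ + (r₂ - r₁) := by
    refine ⟨-(-θ / (r₂ - r₁)), ?_, ?_⟩
    · have := Int.mul_ediv_self_le (x := -θ) hL.ne'
      linarith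
    · have := Int.lt_mul_ediv_self_add (x := -θ) hL
      linarith
  have hcorner₁ := (hmem r₁ (lo r₁)).2 (by omega)
  have hcorner₂ := (hmem r₁ (lo r₁ + (l + 1))).2 (by omega)
  have hcorner₃ := (hmem r₂ (lo r₂)).2 (by omega)
  have hcorner₄ := (hmem r₂ (lo r₂ + (l + 1))).2 (by omega)
  have hrect : ∀ i, θ ≤ (r₂ - r₁) * i → (r₂ - r₁) * i ≤ θ + (r₂ - r₁) * (l + 1) →
      lo r ≤ i ∧ i < lo r + len r := by
    intro i hi hi'
    have hi'' : (r₂ - r₁) * i ≤ (r₂ - r) * (lo r₁ + (l + 1)) + (r - r₁) * (lo r₂ + (l + 1)) := by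
      linarith
    refine (hmem r i).1 ?_
    simp only [rect, rowEquiv, Equiv.coe_fn_mk, Set.mem_ofPred_eq]
      at hcorner₁ hcorner₂ hcorner₃ hcorner₄ ⊢
    have key : ∀ A α β : ℤ, _ := fun A α β => le_of_mem_trapezoid (A := A) (α := α) (β := β)
      h₁ h₂ (h₁'.trans_le h₂) (x := lo r₁) (y := lo r₂) (l := l + 1) (j := i)
    refine ⟨?_, ?_, ?_, ?_⟩
    · linarith [key 1 w.1 (-u.2) (by linarith) (by linarith) (by linarith) (by linarith) hi hi'']
    · linarith [key (-n) (-w.1) u.2 (by linarith) (by linarith) (by linarith) (by linarith) hi hi'']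
    · linarith [key 1 w.2 u.1 (by linarith) (by linarith) (by linarith) (by linarith) hi hi'']
    · linarith [key (-m) (-w.2) (-u.1) (by linarith) (by linarith) (by linarith) (by linarith)
        hi hi'']
  have hl0 : 0 ≤ (r₂ - r₁) * (l : ℤ) := by positivity
  have hfirst := hrect j hj (by linarith)
  have hlast := hrect (j + l) (by linarith) (by linarith)
  omega

theorem shift_mem_orbitClosure {A : Type*} [TopologicalSpace A] {c x : ℤ × ℤ → A}
    (hx : x ∈ orbitClosure c) (t : ℤ × ℤ) : (fun p => x (t + p)) ∈ orbitClosure c := by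
  refine map_mem_closure (f := fun (x : ℤ × ℤ → A) p => x (t + p)) (by fun_prop) hx ?_
  rintro _ ⟨s, rfl⟩
  exact ⟨s - t, funext fun p => congrArg c (show t + p - s = p - (s - t) by abel)⟩

theorem self_mem_orbitClosure {A : Type*} [TopologicalSpace A] (c : ℤ × ℤ → A) :
    c ∈ orbitClosure c :=
  subset_closure ⟨0, funext fun p => congrArg c (sub_zero p).symm⟩

/-- The patterns of the orbit closure are patterns of the configuration itself. -/
theorem ncard_language_orbitClosure_le {A : Type*} [Finite A] [TopologicalSpace A]
    [DiscreteTopology A] (c : ℤ × ℤ → A) (D : Finset (ℤ × ℤ)) (E : Set (ℤ × ℤ)) (hE : E = ↑D) :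
    (language (orbitClosure c) D).ncard ≤ (patterns c E).ncard := by
  subst hE
  refine Set.ncard_le_ncard_of_injOn (fun p x => p x) ?_ (fun p _ q _ h => h) (Set.toFinite _)
  rintro _ ⟨y, hy, rfl⟩
  obtain ⟨_, hz, t, rfl⟩ := mem_closure_iff.1 hy _
    (isOpen_set_pi D.finite_toSet fun i _ => isOpen_discrete {y i}) fun i _ => rfl
  exact ⟨t, fun x => (hz x x.2).symm⟩

/-- Every period of a configuration is a period of all members of its orbit closure. -/
theorem translate_eq_of_mem_orbitClosure {A : Type*} [TopologicalSpace A] [T2Space A]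
    {c d : ℤ × ℤ → A} (hc : c ∈ orbitClosure d) {t : ℤ × ℤ} (ht : Translate t d = d) :
    Translate t c = c := by
  have hclosed : IsClosed {x : ℤ × ℤ → A | Translate t x = x} :=
    isClosed_eq (by unfold Translate; fun_prop) continuous_id
  refine closure_minimal ?_ hclosed hc
  rintro _ ⟨s, rfl⟩
  funext p
  have := congrFun ht (p - s)
  simpa [Translate, sub_right_comm] using this

/-- If a uniformly recurrent configuration over a finite alphabet
has low complexity with respect to a rectangle, and both `u` and `−u` are
directions of non-determinism of its orbit closure, then the configuration is
periodic in a direction perpendicular to `u`. -/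
theorem periodic_of_two_sided_nondeterminism
    {A : Type*} [Fintype A] [TopologicalSpace A] [DiscreteTopology A]
    (c : ℤ × ℤ → A) (hur : UniformlyRecurrent c)
    (n m : ℕ) (hn : 1 ≤ n) (hm : 1 ≤ m)
    (hlc : (patterns c (rect n m)).ncard ≤ n * m)
    (u : ℤ × ℤ) (hu : u ≠ 0)
    (hnd1 : ¬ DeterministicIn (orbitClosure c) u)
    (hnd2 : ¬ DeterministicIn (orbitClosure c) (-u)) :
    ∃ p : ℤ × ℤ, p ≠ 0 ∧ inner2 p u = 0 ∧ Translate p c = c := by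
  have hgcd : 0 < Int.gcd u.1 u.2 := by
    refine Nat.pos_of_ne_zero fun h => hu ?_
    obtain ⟨h1, h2⟩ := Int.gcd_eq_zero_iff.1 h
    exact Prod.ext h1 h2
  obtain ⟨u₁, u₂, hcop, hu₁, hu₂⟩ := Int.exists_gcd_one hgcd
  obtain ⟨w₁, w₂, hw⟩ := Int.isCoprime_iff_gcd_eq_one.2 hcop
  set g : ℤ := (Int.gcd u.1 u.2 : ℤ) with hg
  have hgpos : 0 < g := Int.natCast_pos.2 hgcd
  have hw' : inner2 (w₁, w₂) (u₁, u₂) = 1 := hw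
  set σ := rowEquiv (u₁, u₂) (w₁, w₂) hw' with hσ
  have hinner : ∀ p, inner2 (σ p) u = p.1 * g := fun p => by
    rw [← inner2_rowEquiv (u₁, u₂) (w₁, w₂) hw' p, ← hσ]
    simp only [inner2]
    rw [hu₁, hu₂]
    ring
  obtain ⟨lo, len, hmem, hlen⟩ := exists_rect_rows n m (u₁, u₂) (w₁, w₂) hw'
  rw [← hσ] at hmem
  set D := Finset.Icc (1 : ℤ) n ×ˢ Finset.Icc (1 : ℤ) m with hD
  obtain ⟨a, ha⟩ := (D.image fun x => (σ.symm x).1).bddBelow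
  obtain ⟨b, hb⟩ := (D.image fun x => (σ.symm x).1).bddAbove
  have hmap : (strip lo len a b).map σ.toEmbedding = D := by
    ext x
    rw [Finset.mem_map_equiv, mem_strip, ← hmem, Prod.mk.eta, σ.apply_symm_apply, rect_eq_coe,
      Finset.mem_coe, and_iff_right_iff_imp]
    exact fun hx => ⟨ha (Finset.mem_image_of_mem _ hx), hb (Finset.mem_image_of_mem _ hx)⟩
  have hcard : (strip lo len a b).card = n * m := by
    rw [← Finset.card_map σ.toEmbedding, hmap, hD, Finset.card_product]
    simp
  unfold DeterministicIn at hnd1 hnd2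
  push Not at hnd1 hnd2
  obtain ⟨_, ⟨d, hd, rfl⟩, q, hq, hper⟩ := exists_row_periodic_mem
    (X := (fun x => x ∘ σ) '' orbitClosure c)
    (by
      rintro _ ⟨x, hx, rfl⟩ t
      exact ⟨_, shift_mem_orbitClosure hx (σ t), funext fun p => by
        simp only [Function.comp_apply, hσ, rowEquiv_add]⟩)
    hlen
    (by
      obtain ⟨d, hd, e, he, hde, hne⟩ := hnd1
      refine ⟨_, ⟨d, hd, rfl⟩, _, ⟨e, he, rfl⟩, fun p hp => hde ?_, fun h => hne ?_⟩
      · change inner2 (σ p) u < 0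
        rw [hinner]
        exact mul_neg_of_neg_of_pos hp hgpos
      · exact σ.surjective.injective_comp_right h)
    (by
      obtain ⟨d, hd, e, he, hde, hne⟩ := hnd2
      refine ⟨_, ⟨d, hd, rfl⟩, _, ⟨e, he, rfl⟩, fun p hp => hde ?_, fun h => hne ?_⟩
      · change inner2 (σ p) (-u) < 0
        have h1 : inner2 (σ p) (-u) = -inner2 (σ p) u := by simp [inner2]; ring
        rw [h1, hinner]
        exact neg_neg_of_pos (mul_pos hp hgpos)
      · exact σ.surjective.injective_comp_right h)
    (b + 1 - a).toNat a b (Int.self_le_toNat _)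
    (by
      rw [ncard_language_comp, hmap, hcard]
      exact (ncard_language_orbitClosure_le c D _ (rect_eq_coe n m)).trans hlc)
  have hq' : (q : ℤ) ≠ 0 := by exact_mod_cast hq.ne'
  refine ⟨σ (0, q), fun h0 => ?_, by rw [hinner, zero_mul], ?_⟩
  · have hσ0 : σ (0, 0) = 0 := by ext <;> simp [hσ, rowEquiv]
    have := σ.injective (h0.trans hσ0.symm)
    exact hq' (congrArg Prod.snd this)
  · refine translate_eq_of_mem_orbitClosure (d := d)
      (by rw [hur d hd]; exact self_mem_orbitClosure c) (funext fun x => ?_)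
    have h := hper (σ.symm (x - σ (0, q)))
    simp only [Function.comp_apply, hσ, rowEquiv_add, Equiv.apply_symm_apply,
      sub_add_cancel] at h
    exact h.symm
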